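/- Let G be a homogeneous m-generic L-graph such that O(G) contains a C_{01}-cover set. Then for every 𝒜 ∈ Λ, the quasi-order (𝒜, ≤_{01}) has at least two maximal elements which are not off-E_{01}-isomorphic to each other (i.e. t_𝒜 ≥ 2, where t_𝒜 is the number of maximal elements of (𝒜, ≤_{01}) counted up to off-E_{01}-isomorphism). -/

import Mathlib

/-!
Common framework: coloured multipartite graphs in a finite language `L`.
Colours are natural numbers; for each pair of distinct parts `i j : Fin m`
there is a finite nonempty colour set `C i j`.
-/

/-- A finite language for coloured `m`-partite graphs. -/
structure MLang (m : ℕ) where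
  C : Fin m → Fin m → Finset ℕ
  symm : ∀ i j, C i j = C j i
  nonempty : ∀ i j, i ≠ j → (C i j).Nonempty

/-- A coloured `m`-partite `L`-graph: vertices partitioned into parts `V_0, …, V_{m-1}`,
with a symmetric colouring of cross-part pairs taking values in the colour sets of `L`.
(The value of `colour` on pairs within a part is irrelevant junk data.) -/
structure LGraph {m : ℕ} (L : MLang m) where
  V : Type
  part : V → Fin m
  colour : V → V → ℕ
  colour_symm : ∀ x y, colour x y = colour y x
  colour_mem : ∀ x y, part x ≠ part y → colour x y ∈ L.C (part x) (part y)

namespace LGraph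

variable {m : ℕ} {L : MLang m}

/-- The induced subgraph of `A` on a set `S` of its vertices. -/
def restrict (A : LGraph L) (S : Set A.V) : LGraph L where
  V := S
  part x := A.part x.1
  colour x y := A.colour x.1 y.1
  colour_symm := fun x y => A.colour_symm x.1 y.1
  colour_mem := fun x y h => A.colour_mem x.1 y.1 h

/-- `f` is an embedding of `A` into `G`: injective, part-preserving, colour-preserving. -/
def IsEmbedding (A G : LGraph L) (f : A.V → G.V) : Prop :=
  Function.Injective f ∧ (∀ x, G.part (f x) = A.part x) ∧
    ∀ x y : A.V, A.part x ≠ A.part y → G.colour (f x) (f y) = A.colour x y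

/-- `A` is realized in `G`, i.e. `A` embeds into `G`. -/
def Realized (G A : LGraph L) : Prop := ∃ f : A.V → G.V, IsEmbedding A G f

/-- `A` and `B` are isomorphic `L`-graphs. -/
def IsIsomorphic (A B : LGraph L) : Prop :=
  ∃ f : A.V → B.V, IsEmbedding A B f ∧ Function.Surjective f

/-- `φ` restricted to `S` is an isomorphism between induced subgraphs of `G`
(a partial automorphism of `G`). -/
def IsPartialIso (G : LGraph L) (S : Set G.V) (φ : G.V → G.V) : Prop :=
  Set.InjOn φ S ∧ (∀ x ∈ S, G.part (φ x) = G.part x) ∧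
    ∀ x ∈ S, ∀ y ∈ S, G.part x ≠ G.part y → G.colour (φ x) (φ y) = G.colour x y

/-- `G` is homogeneous: every isomorphism between finite induced subgraphs of `G`
extends to an automorphism of `G`. -/
def Homogeneous (G : LGraph L) : Prop :=
  ∀ S : Set G.V, S.Finite → ∀ φ : G.V → G.V, G.IsPartialIso S φ →
    ∃ ψ : G.V ≃ G.V, (∀ x, G.part (ψ x) = G.part x) ∧
      (∀ x y : G.V, G.part x ≠ G.part y → G.colour (ψ x) (ψ y) = G.colour x y) ∧
      ∀ x ∈ S, ψ x = φ x

/-- `G` is `m`-generic: every part is countably infinite and every bipartite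
restriction is generic. -/
def Generic (G : LGraph L) : Prop :=
  Countable G.V ∧ (∀ i : Fin m, {x : G.V | G.part x = i}.Infinite) ∧
    ∀ i j : Fin m, i ≠ j → ∀ U : Finset G.V, (∀ u ∈ U, G.part u = i) →
      ∀ f : G.V → ℕ, (∀ u ∈ U, f u ∈ L.C i j) →
        ∃ x : G.V, G.part x = j ∧ ∀ u ∈ U, G.colour x u = f u

/-- `A` is minimally omitted from `G` (membership in `O(G)`): `A` is finite and omitted,
but every proper induced subgraph of `A` is realized in `G`. -/
def MinOmitted (G A : LGraph L) : Prop :=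
  Finite A.V ∧ ¬ G.Realized A ∧ ∀ S : Set A.V, S ≠ Set.univ → G.Realized (A.restrict S)

/-- `A` is monic: at most one vertex in each part. -/
def Monic (A : LGraph L) : Prop := ∀ x y : A.V, A.part x = A.part y → x = y

/-- `A` covers colour `c` on the restriction `V_i V_j`: it has vertices in `V_i` and `V_j`
joined by a `c`-coloured edge. -/
def Covers (A : LGraph L) (i j : Fin m) (c : ℕ) : Prop :=
  ∃ x y : A.V, A.part x = i ∧ A.part y = j ∧ A.colour x y = c

/-- `A` is an `ijk`-triangle: a monic with vertices in exactly the parts `V_i, V_j, V_k`. -/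
def IsTriangleOn (A : LGraph L) (i j k : Fin m) : Prop :=
  A.Monic ∧ (∀ x : A.V, A.part x = i ∨ A.part x = j ∨ A.part x = k) ∧
    (∃ x : A.V, A.part x = i) ∧ (∃ x : A.V, A.part x = j) ∧ (∃ x : A.V, A.part x = k)

/-- `A` is a triangle: an `ijk`-triangle for some pairwise distinct `i, j, k`. -/
def IsTriangle (A : LGraph L) : Prop :=
  ∃ i j k : Fin m, i ≠ j ∧ i ≠ k ∧ j ≠ k ∧ A.IsTriangleOn i j k

end LGraph

open LGraph

variable {m : ℕ} {L : MLang m}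

/-- A `C_{ij}`-cover set: a set of monics covering every colour of `C i j` on `V_i V_j`. -/
def IsCoverSet (𝒜 : Set (LGraph L)) (i j : Fin m) : Prop :=
  (∀ A ∈ 𝒜, A.Monic) ∧ ∀ c ∈ L.C i j, ∃ A ∈ 𝒜, A.Covers i j c

/-- A `C_{ij}^{kl}`-omission set with code `(i,j,k,l; cik, cil, cjk, cjl)`:
a `C_{ij}`-cover set of `ijk`-triangles and `ijl`-triangles all of whose
`E_{ik}, E_{il}, E_{jk}, E_{jl}`-edges have the indicated colours. -/
def IsOmissionSet (S : Set (LGraph L)) (i j k l : Fin m) (cik cil cjk cjl : ℕ) : Prop :=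
  IsCoverSet S i j ∧
  (∀ A ∈ S, A.IsTriangleOn i j k ∨ A.IsTriangleOn i j l) ∧
  (∀ A ∈ S, ∀ x y : A.V, A.part x = i → A.part y = k → A.colour x y = cik) ∧
  (∀ A ∈ S, ∀ x y : A.V, A.part x = i → A.part y = l → A.colour x y = cil) ∧
  (∀ A ∈ S, ∀ x y : A.V, A.part x = j → A.part y = k → A.colour x y = cjk) ∧
  (∀ A ∈ S, ∀ x y : A.V, A.part x = j → A.part y = l → A.colour x y = cjl)

/-- The code `(i,j,k,l; cik, cil, cjk, cjl)` is based on the cover set `𝒜`. -/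
def BasedOn (𝒜 : Set (LGraph L)) (i j k l : Fin m) (cik cil cjk cjl : ℕ) : Prop :=
  ∃ A ∈ 𝒜, ∃ A' ∈ 𝒜,
    A.Covers i k cik ∧ A.Covers j k cjk ∧ A'.Covers i l cil ∧ A'.Covers j l cjl

/-- The code `(i,j,k,l; cik, cil, cjk, cjl)` is based on triangles from the cover set `𝒜`. -/
def BasedOnTriangles (𝒜 : Set (LGraph L)) (i j k l : Fin m) (cik cil cjk cjl : ℕ) : Prop :=
  ∃ A ∈ 𝒜, ∃ A' ∈ 𝒜, A.IsTriangle ∧ A'.IsTriangle ∧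
    A.Covers i k cik ∧ A.Covers j k cjk ∧ A'.Covers i l cil ∧ A'.Covers j l cjl

/-- The age of `G`: the class of finite `L`-graphs embedding into `G`. -/
def Age (G : LGraph L) : Set (LGraph L) := {A | Finite A.V ∧ G.Realized A}

/-- `Forb F`: the class of finite `L`-graphs into which no member of `F` embeds. -/
def Forb (F : Set (LGraph L)) : Set (LGraph L) :=
  {B | Finite B.V ∧ ∀ A ∈ F, ¬ B.Realized A}

/-- An amalgamation class: a class of finite `L`-graphs closed under isomorphism and
induced subgraphs with the amalgamation property. -/
def IsAmalgamationClass (𝒞 : Set (LGraph L)) : Prop :=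
  (∀ A ∈ 𝒞, Finite A.V) ∧
  (∀ A ∈ 𝒞, ∀ B : LGraph L, A.IsIsomorphic B → B ∈ 𝒞) ∧
  (∀ A ∈ 𝒞, ∀ S : Set A.V, A.restrict S ∈ 𝒞) ∧
  ∀ A B₁ B₂ : LGraph L, A ∈ 𝒞 → B₁ ∈ 𝒞 → B₂ ∈ 𝒞 →
    ∀ (f₁ : A.V → B₁.V) (f₂ : A.V → B₂.V),
      IsEmbedding A B₁ f₁ → IsEmbedding A B₂ f₂ →
      ∃ C ∈ 𝒞, ∃ (g₁ : B₁.V → C.V) (g₂ : B₂.V → C.V),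
        IsEmbedding B₁ C g₁ ∧ IsEmbedding B₂ C g₂ ∧ g₁ ∘ f₁ = g₂ ∘ f₂

section Parts01

variable [NeZero m]

/-- `A ≤₀₁ B`: `A` is an off-`E_{01}`-subgraph of `B`, i.e. `A` embeds into `B` ignoring
the colours of edges between `V_0` and `V_1` (equivalently, `A` embeds into the graph
obtained from `B` by recolouring its `E_{01}`-edge with the `E_{01}`-colour of `A`). -/
def Le01 (A B : LGraph L) : Prop :=
  ∃ f : A.V → B.V, Function.Injective f ∧ (∀ x, B.part (f x) = A.part x) ∧
    ∀ x y : A.V, A.part x ≠ A.part y →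
      ¬((A.part x = 0 ∧ A.part y = 1) ∨ (A.part x = 1 ∧ A.part y = 0)) →
      B.colour (f x) (f y) = A.colour x y

/-- `A` and `B` are off-`E_{01}`-isomorphic. -/
def OffIso01 (A B : LGraph L) : Prop := Le01 A B ∧ Le01 B A

/-- `A` is a maximal element of the quasi-order `(𝒜, ≤₀₁)`. -/
def MaxIn (𝒜 : Set (LGraph L)) (A : LGraph L) : Prop :=
  A ∈ 𝒜 ∧ ∀ B ∈ 𝒜, Le01 A B → Le01 B A

/-- `𝒜 ∈ Λ`: a `C_{01}`-cover set contained in `O(G)` of size exactly `|C_{01}|`. -/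
def InLambda (G : LGraph L) (𝒜 : Set (LGraph L)) : Prop :=
  (∀ A ∈ 𝒜, G.MinOmitted A) ∧ IsCoverSet 𝒜 0 1 ∧ 𝒜.ncard = (L.C 0 1).card

/-- The graph obtained from `A` by recolouring its `E_{01}`-edge with `α`
(that is, `A^{c/α}` where `c` is the `E_{01}`-colour of `A`) is realized in `G`. -/
def RealizedRecoloured01 (G A : LGraph L) (α : ℕ) : Prop :=
  ∃ f : A.V → G.V, Function.Injective f ∧ (∀ x, G.part (f x) = A.part x) ∧
    (∀ x y : A.V, A.part x ≠ A.part y →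
      ¬((A.part x = 0 ∧ A.part y = 1) ∨ (A.part x = 1 ∧ A.part y = 0)) →
      G.colour (f x) (f y) = A.colour x y) ∧
    ∀ x y : A.V, A.part x = 0 → A.part y = 1 → G.colour (f x) (f y) = α

/-- `Ω₀₁(𝒜) ⊆ Ω₀₁(ℬ)`: every code `(0,1,k,l; c_{0k}, c_{0l}, c_{1k}, c_{1l})`
based on `𝒜` is based on `ℬ`. -/
def Omega01Le (𝒜 ℬ : Set (LGraph L)) : Prop :=
  ∀ k l : Fin m, k ≠ l → k ≠ 0 → k ≠ 1 → l ≠ 0 → l ≠ 1 →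
    ∀ c0k c0l c1k c1l : ℕ,
      BasedOn 𝒜 0 1 k l c0k c0l c1k c1l → BasedOn ℬ 0 1 k l c0k c0l c1k c1l

/-- `ℬ` is a good `C_{01}`-cover set (for `G`): there is a key colour `α ∈ C_{01}` with key
monic `A^α ∈ ℬ` such that every member of `ℬ`, after recolouring its `E_{01}`-edge by `α`,
is either an (off-`E_{01}`-)subgraph of `A^α` or realized in `G`. -/
def GoodCoverSet (G : LGraph L) (ℬ : Set (LGraph L)) : Prop :=
  ∃ α ∈ L.C 0 1, ∃ Aα ∈ ℬ, Aα.Covers 0 1 α ∧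
    ∀ A ∈ ℬ, Le01 A Aα ∨ RealizedRecoloured01 G A α

/-- `ℬ` is a star `C_{01}`-cover set: good, with a key monic which either has vertices
in at least four parts, or has vertices in exactly three parts `V_0, V_1, V_i` while no
other member of `ℬ` has vertices in all of the remaining parts. -/
def StarCoverSet (G : LGraph L) (ℬ : Set (LGraph L)) : Prop :=
  ∃ α ∈ L.C 0 1, ∃ Aα ∈ ℬ, Aα.Covers 0 1 α ∧
    (∀ A ∈ ℬ, Le01 A Aα ∨ RealizedRecoloured01 G A α) ∧
    (4 ≤ (Set.range Aα.part).ncard ∨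
      ∃ i : Fin m, i ≠ 0 ∧ i ≠ 1 ∧ Set.range Aα.part = {0, 1, i} ∧
        ∀ B ∈ ℬ, B ≠ Aα → ∃ p : Fin m, p ≠ 0 ∧ p ≠ 1 ∧ p ≠ i ∧ p ∉ Set.range B.part)

/-- `B` is a copy of the monic `B^{cd}` (relative to the background colours `α`): a monic
with exactly one vertex in every part, `E_{01}`-colour `c`, `E_{12}`-colour `d`, and
`E_{ij}`-colour `α i j` for every other pair of distinct parts. -/
def IsBcd (B : LGraph L) (α : Fin m → Fin m → ℕ) (c d : ℕ) : Prop :=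
  B.Monic ∧ (∀ i : Fin m, ∃ x : B.V, B.part x = i) ∧
  (∀ x y : B.V, B.part x = 0 → B.part y = 1 → B.colour x y = c) ∧
  (∀ x y : B.V, B.part x = 1 → B.part y = 2 → B.colour x y = d) ∧
  (∀ x y : B.V, B.part x ≠ B.part y →
    ¬((B.part x = 0 ∧ B.part y = 1) ∨ (B.part x = 1 ∧ B.part y = 0)) →
    ¬((B.part x = 1 ∧ B.part y = 2) ∨ (B.part x = 2 ∧ B.part y = 1)) →
    B.colour x y = α (B.part x) (B.part y))

end Parts01

theorem le01_refl' [NeZero m] (A : LGraph L) : Le01 A A :=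
  ⟨id, Function.injective_id, fun _ => rfl, fun _ _ _ _ => rfl⟩

theorem le01_trans' [NeZero m] {A B D : LGraph L} (h₁ : Le01 A B) (h₂ : Le01 B D) :
    Le01 A D := by
  obtain ⟨f, fi, fp, fc⟩ := h₁
  obtain ⟨g, gi, gp, gc⟩ := h₂
  refine ⟨g ∘ f, gi.comp fi, fun x => by simp [gp, fp], fun x y hxy h => ?_⟩
  rw [← fc x y hxy h]
  exact gc (f x) (f y) (by rwa [fp, fp]) (by rwa [fp, fp])

theorem realized_total {G A : LGraph L} (v : G.V) {S : Set A.V}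
    (h : G.Realized (A.restrict S)) :
    ∃ f : A.V → G.V, Set.InjOn f S ∧ (∀ x ∈ S, G.part (f x) = A.part x) ∧
      ∀ x ∈ S, ∀ y ∈ S, A.part x ≠ A.part y → G.colour (f x) (f y) = A.colour x y := by
  classical
  obtain ⟨f, fi, fp, fc⟩ := h
  have e : ∀ x (hx : x ∈ S), (if h : x ∈ S then f ⟨x, h⟩ else v) = f ⟨x, hx⟩ :=
    fun x hx => dif_pos hx
  refine ⟨fun x => if h : x ∈ S then f ⟨x, h⟩ else v, ?_, ?_, ?_⟩
  · intro x hx y hy hxy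
    simp only [e x hx, e y hy] at hxy
    exact congrArg Subtype.val (fi hxy)
  · intro x hx
    simp only [e x hx]
    exact fp ⟨x, hx⟩
  · intro x hx y hy hxy
    simp only [e x hx, e y hy]
    exact fc ⟨x, hx⟩ ⟨y, hy⟩ hxy

/-- Amalgamation over `M` minus its vertices in `V_0` and `V_1`. -/
theorem amalgamate_off01 [NeZero m] {G M : LGraph L} (hG : G.Homogeneous) (v : G.V)
    (h01 : (0 : Fin m) ≠ 1)
    (hM : G.MinOmitted M) (hmon : M.Monic) (a b : M.V) (ha : M.part a = 0) (hb : M.part b = 1) :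
    ∃ h : M.V → G.V, Function.Injective h ∧ (∀ x, G.part (h x) = M.part x) ∧
      ∀ x y : M.V, M.part x ≠ M.part y →
      ¬((M.part x = 0 ∧ M.part y = 1) ∨ (M.part x = 1 ∧ M.part y = 0)) →
      G.colour (h x) (h y) = M.colour x y := by
  classical
  obtain ⟨hfin, -, hsub⟩ := hM
  obtain ⟨f, fi, fp, fc⟩ := realized_total v (hsub {x | x ≠ a} (fun h => by
    have : a ∈ {x | x ≠ a} := h ▸ Set.mem_univ a
    exact this rfl))
  obtain ⟨g, gi, gp, gc⟩ := realized_total v (hsub {x | x ≠ b} (fun h => by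
    have : b ∈ {x | x ≠ b} := h ▸ Set.mem_univ b
    exact this rfl))
  have hab : a ≠ b := fun h => h01 (by rw [← ha, ← hb, h])
  haveI : Nonempty M.V := ⟨a⟩
  let B : Set M.V := {x | x ≠ a ∧ x ≠ b}
  have gB : Set.InjOn g B := gi.mono (fun x hx => hx.2)
  have hinv : ∀ x ∈ B, Function.invFunOn g B (g x) = x := fun x hx =>
    gB.leftInvOn_invFunOn hx
  obtain ⟨ψ, ψp, ψc, ψe⟩ := hG (g '' B) (Set.toFinite _) (f ∘ Function.invFunOn g B) (by
    refine ⟨?_, ?_, ?_⟩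
    · rintro _ ⟨x, hx, rfl⟩ _ ⟨y, hy, rfl⟩ h
      simp only [Function.comp, hinv x hx, hinv y hy] at h
      rw [fi hx.1 hy.1 h]
    · rintro _ ⟨x, hx, rfl⟩
      simp only [Function.comp, hinv x hx]
      rw [fp x hx.1, gp x hx.2]
    · rintro _ ⟨x, hx, rfl⟩ _ ⟨y, hy, rfl⟩ h
      simp only [Function.comp, hinv x hx, hinv y hy]
      rw [gp x hx.2, gp y hy.2] at h
      rw [fc x hx.1 y hy.1 h, gc x hx.2 y hy.2 h])
  have hψ : ∀ x ∈ B, ψ (g x) = f x := fun x hx => by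
    rw [ψe _ ⟨x, hx, rfl⟩]
    simp only [Function.comp, hinv x hx]
  let h : M.V → G.V := fun x => if x = a then ψ (g a) else f x
  have h1 : h a = ψ (g a) := if_pos rfl
  have h2 : ∀ x, x ≠ a → h x = f x := fun x hx => if_neg hx
  have hp : ∀ x, G.part (h x) = M.part x := by
    intro x
    by_cases hx : x = a
    · rw [hx, h1, ψp, gp a hab]
    · rw [h2 x hx, fp x hx]
  have key : ∀ y, y ≠ a → y ≠ b → M.part a ≠ M.part y →
      G.colour (h a) (h y) = M.colour a y := by
    intro y hya hyb hne
    rw [h1, h2 y hya, ← hψ y ⟨hya, hyb⟩, ψc, gc a hab y hyb hne]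
    rwa [gp a hab, gp y hyb]
  refine ⟨h, fun x y hxy => hmon x y (by rw [← hp, ← hp, hxy]), hp, fun x y hxy hn => ?_⟩
  by_cases hx : x = a
  · subst hx
    have hya : y ≠ x := fun e => hxy (by rw [e])
    have hyb : y ≠ b := fun e => hn (Or.inl ⟨ha, by rw [e, hb]⟩)
    exact key y hya hyb hxy
  · by_cases hy : y = a
    · subst hy
      have hxb : x ≠ b := fun e => hn (Or.inr ⟨by rw [e, hb], ha⟩)
      rw [G.colour_symm, M.colour_symm]
      exact key x hx hxb hxy.symm
    · rw [h2 x hx, h2 y hy, fc x hx y hy hxy]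

/-- If `O(G)` contains a `C_{01}`-cover set, then every `𝒜 ∈ Λ` has at
least two maximal elements (in the quasi-order `≤₀₁`) which are not
off-`E_{01}`-isomorphic to each other, i.e. `t_𝒜 ≥ 2`. -/
theorem lambda_two_maximal_elements
    {m : ℕ} [NeZero m] {L : MLang m} (hm : 2 ≤ m)
    (G : LGraph L) (hG : G.Homogeneous) (hgen : G.Generic)
    (hcover : ∃ 𝒜₀ : Set (LGraph L),
      (∀ A ∈ 𝒜₀, G.MinOmitted A) ∧ IsCoverSet 𝒜₀ 0 1) :
    ∀ 𝒜 : Set (LGraph L), InLambda G 𝒜 →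
      ∃ A ∈ 𝒜, ∃ B ∈ 𝒜, MaxIn 𝒜 A ∧ MaxIn 𝒜 B ∧ ¬ OffIso01 A B := by
  rintro 𝒜 ⟨hO, ⟨hmonic, hcov⟩, hcard⟩
  have h01 : (0 : Fin m) ≠ 1 := by
    intro h
    have := congrArg Fin.val h
    rw [Fin.val_zero, Fin.val_one', Nat.mod_eq_of_lt (by omega)] at this
    omega
  obtain ⟨v, -⟩ := (hgen.2.1 0).nonempty
  obtain ⟨c₀, hc₀⟩ := L.nonempty 0 1 h01
  obtain ⟨A₀, hA₀, x₀, y₀, hx₀, hy₀, -⟩ := hcov c₀ hc₀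
  have hfin : 𝒜.Finite := by
    apply Set.finite_of_ncard_ne_zero
    rw [hcard]
    exact (Finset.card_pos.2 ⟨c₀, hc₀⟩).ne'
  letI : Preorder (LGraph L) :=
    { le := Le01
      le_refl := le01_refl'
      le_trans := fun _ _ _ => le01_trans' }
  have hmax : ∀ A ∈ 𝒜, ∃ M, Le01 A M ∧ MaxIn 𝒜 M := by
    intro A hA
    obtain ⟨M, hAM, hM⟩ := hfin.exists_le_maximal hA
    exact ⟨M, hAM, hM.1, fun B hB h => hM.2 hB h⟩
  by_contra hcon
  push Not at hcon
  obtain ⟨M, hA₀M, hM⟩ := hmax A₀ hA₀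
  have htop : ∀ A ∈ 𝒜, Le01 A M := by
    intro A hA
    obtain ⟨N, hAN, hN⟩ := hmax A hA
    exact le01_trans' hAN (hcon N hN.1 M hM.1 hN hM).1
  obtain ⟨f₀, -, f₀p, -⟩ := hA₀M
  have ha : M.part (f₀ x₀) = 0 := by rw [f₀p, hx₀]
  have hb : M.part (f₀ y₀) = 1 := by rw [f₀p, hy₀]
  obtain ⟨h, hi, hp, hc⟩ := amalgamate_off01 hG v h01 (hO M hM.1) (hmonic M hM.1) _ _ ha hb
  have hmem := G.colour_mem (h (f₀ x₀)) (h (f₀ y₀)) (by rwa [hp, hp, ha, hb])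
  rw [hp, hp, ha, hb] at hmem
  obtain ⟨A, hA, x, y, hx, hy, hxy⟩ := hcov _ hmem
  obtain ⟨f, fi, fp, fc⟩ := htop A hA
  have fx : f x = f₀ x₀ := hmonic M hM.1 _ _ (by rw [fp, hx, ha])
  have fy : f y = f₀ y₀ := hmonic M hM.1 _ _ (by rw [fp, hy, hb])
  refine (hO A hA).2.1 ⟨h ∘ f, hi.comp fi, fun z => by simp [hp, fp], fun z w hzw => ?_⟩
  by_cases hE : (A.part z = 0 ∧ A.part w = 1) ∨ (A.part z = 1 ∧ A.part w = 0)
  · rcases hE with ⟨hz, hw⟩ | ⟨hz, hw⟩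
    · obtain rfl : z = x := hmonic A hA _ _ (by rw [hz, hx])
      obtain rfl : w = y := hmonic A hA _ _ (by rw [hw, hy])
      simp only [Function.comp, fx, fy, hxy]
    · obtain rfl : z = y := hmonic A hA _ _ (by rw [hz, hy])
      obtain rfl : w = x := hmonic A hA _ _ (by rw [hw, hx])
      simp only [Function.comp, fx, fy]
      rw [G.colour_symm, A.colour_symm, hxy]
  · rw [← fc z w hzw hE]
    exact hc (f z) (f w) (by rwa [fp, fp]) (by rwa [fp, fp])
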